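/- arXiv:2104.06765 — 2 statements merged into one kernel-verified Lean document; each statement's English description precedes it below -/
import Mathlib

section
/- Let p be a prime and m ≥ 1, and equip the m×m matrices over the p-adic field ℚ_p with the entrywise sup norm ‖A‖ := max_{i,j} |A_{ij}|_p. Let a be an invertible m×m matrix over ℚ_p and suppose there exists an invertible m×m matrix g over ℚ_p such that g·a·g⁻¹ is a diagonal matrix with ‖g·a·g⁻¹‖ > 1. Then the set { log ‖aⁿ‖ : n ∈ ℕ, n ≥ 1 } has bounded gaps: there exists Δ > 0 such that for every t ≥ 0 there exists n ≥ 1 with t ≤ log ‖aⁿ‖ ≤ t + Δ. -/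
/-- Bounded gaps for the logarithms of sup norms of powers of a diagonalizable p-adic
matrix with `‖g·a·g⁻¹‖ > 1` (the key step of Lemma 3.1(b) of the paper). -/
theorem log_norm_powers_bounded_gaps (p : ℕ) [Fact p.Prime] (m : ℕ) (hm : 1 ≤ m)
    (nrm : Matrix (Fin m) (Fin m) ℚ_[p] → ℝ)
    (hnrm : ∀ A : Matrix (Fin m) (Fin m) ℚ_[p],
      nrm A = ((Finset.univ.sup fun ij : Fin m × Fin m => ‖A ij.1 ij.2‖₊ : NNReal) : ℝ))
    (a g : Matrix (Fin m) (Fin m) ℚ_[p]) (ha : IsUnit a) (hg : IsUnit g)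
    (hdiag : (g * a * g⁻¹).IsDiag) (hbig : 1 < nrm (g * a * g⁻¹)) :
    ∃ Δ : ℝ, 0 < Δ ∧ ∀ t : ℝ, 0 ≤ t → ∃ n : ℕ, 1 ≤ n ∧
      t ≤ Real.log (nrm (a ^ n)) ∧ Real.log (nrm (a ^ n)) ≤ t + Δ := by
  have hle : ∀ (A : Matrix (Fin m) (Fin m) ℚ_[p]) (i j : Fin m), ‖A i j‖ ≤ nrm A := by
    intro A i j
    rw [hnrm, ← coe_nnnorm, NNReal.coe_le_coe]
    exact Finset.le_sup (f := fun ij : Fin m × Fin m => ‖A ij.1 ij.2‖₊) (Finset.mem_univ (i, j))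
  have hub : ∀ (A : Matrix (Fin m) (Fin m) ℚ_[p]) (x : ℝ), 0 ≤ x →
      (∀ i j, ‖A i j‖ ≤ x) → nrm A ≤ x := by
    intro A x hx h
    lift x to NNReal using hx
    rw [hnrm, NNReal.coe_le_coe]
    exact Finset.sup_le fun ij _ => h ij.1 ij.2
  have h0 : ∀ A, 0 ≤ nrm A := by
    intro A
    rw [hnrm]
    exact NNReal.coe_nonneg _
  have hmul : ∀ A B, nrm (A * B) ≤ nrm A * nrm B := by
    intro A B
    refine hub _ _ (mul_nonneg (h0 A) (h0 B)) fun i j => ?_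
    rw [Matrix.mul_apply]
    refine IsUltrametricDist.norm_sum_le_of_forall_le_of_nonneg (mul_nonneg (h0 A) (h0 B))
      fun k _ => ?_
    rw [norm_mul]
    exact mul_le_mul (hle A i k) (hle B k j) (norm_nonneg _) (h0 A)
  have hdet : IsUnit g.det := (Matrix.isUnit_iff_isUnit_det g).1 hg
  have h1 : g⁻¹ * g = 1 := Matrix.nonsing_inv_mul g hdet
  have hconj : ∀ n : ℕ, (g * a * g⁻¹) ^ n = g * a ^ n * g⁻¹ := by
    intro n
    induction n with
    | zero => simp [Matrix.mul_nonsing_inv g hdet]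
    | succ k ih =>
      rw [pow_succ, ih, pow_succ]
      calc g * a ^ k * g⁻¹ * (g * a * g⁻¹) = g * a ^ k * (g⁻¹ * g) * a * g⁻¹ := by
            simp only [mul_assoc]
        _ = _ := by rw [h1]; simp only [mul_assoc, one_mul]
  have hconj2 : ∀ n : ℕ, a ^ n = g⁻¹ * (g * a * g⁻¹) ^ n * g := by
    intro n
    rw [hconj]
    calc a ^ n = (g⁻¹ * g) * a ^ n * (g⁻¹ * g) := by rw [h1]; simp
      _ = _ := by simp only [mul_assoc]
  generalize hD : g * a * g⁻¹ = D at *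
  set r := nrm D with hr
  have hpow : ∀ n : ℕ, nrm (D ^ n) = r ^ n := by
    intro n
    have hr0 : 0 < r := by linarith
    obtain ⟨d, hd⟩ : ∃ d, D = Matrix.diagonal d := ⟨_, hdiag.diagonal_diag.symm⟩
    have hdle : ∀ i, ‖d i‖ ≤ r := by
      intro i
      have := hle D i i
      rwa [hd, Matrix.diagonal_apply_eq, ← hd] at this
    have hDn : D ^ n = Matrix.diagonal (d ^ n) := by rw [hd, Matrix.diagonal_pow]
    apply le_antisymm
    · refine hub _ _ (by positivity) fun i j => ?_
      rw [hDn]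
      by_cases hij : i = j
      · subst hij
        rw [Matrix.diagonal_apply_eq, Pi.pow_apply, norm_pow]
        exact pow_le_pow_left₀ (norm_nonneg _) (hdle i) n
      · rw [Matrix.diagonal_apply_ne _ hij, norm_zero]
        positivity
    · have : Nonempty (Fin m) := ⟨⟨0, hm⟩⟩
      obtain ⟨ij, -, h⟩ := Finset.exists_mem_eq_sup (Finset.univ : Finset (Fin m × Fin m))
        Finset.univ_nonempty (fun ij => ‖D ij.1 ij.2‖₊)
      obtain ⟨i, j⟩ := ij
      have hrij : r = ‖D i j‖ := by rw [hr, hnrm, h]; rfl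
      by_cases hij : i = j
      · subst hij
        have h2 := hle (D ^ n) i i
        rw [hDn, Matrix.diagonal_apply_eq, Pi.pow_apply, norm_pow, ← hDn] at h2
        rwa [hrij, hd, Matrix.diagonal_apply_eq, ← hd]
      · rw [hd, Matrix.diagonal_apply_ne _ hij, norm_zero] at hrij
        linarith
  set C := nrm g * nrm g⁻¹ with hC
  have hC0 : 0 ≤ C := mul_nonneg (h0 _) (h0 _)
  have hA : ∀ n : ℕ, r ^ n ≤ C * nrm (a ^ n) := by
    intro n
    rw [← hpow, hconj]
    calc _ ≤ nrm (g * a ^ n) * nrm g⁻¹ := hmul _ _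
      _ ≤ nrm g * nrm (a ^ n) * nrm g⁻¹ := mul_le_mul_of_nonneg_right (hmul _ _) (h0 _)
      _ = _ := by rw [hC]; ring
  have hB : ∀ n : ℕ, nrm (a ^ n) ≤ C * r ^ n := by
    intro n
    rw [← hpow, hconj2]
    calc _ ≤ nrm (g⁻¹ * D ^ n) * nrm g := hmul _ _
      _ ≤ nrm g⁻¹ * nrm (D ^ n) * nrm g := mul_le_mul_of_nonneg_right (hmul _ _) (h0 _)
      _ = _ := by rw [hC]; ring
  have hrp : 0 < r := by linarith
  have hCp : 0 < C := by
    rcases hC0.lt_or_eq with h | h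
    · exact h
    · have := hA 1
      rw [← h] at this
      simp at this
      linarith
  have hap : ∀ n : ℕ, 0 < nrm (a ^ n) := by
    intro n
    exact pos_of_mul_pos_right ((pow_pos hrp n).trans_le (hA n)) hC0
  have hL : 0 < Real.log r := Real.log_pos hbig
  set L := Real.log r
  have hA' : ∀ n : ℕ, n * L ≤ Real.log C + Real.log (nrm (a ^ n)) := by
    intro n
    have := Real.log_le_log (pow_pos hrp n) (hA n)
    rwa [Real.log_pow, Real.log_mul hCp.ne' (hap n).ne'] at this
  have hB' : ∀ n : ℕ, Real.log (nrm (a ^ n)) ≤ Real.log C + n * L := by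
    intro n
    have := Real.log_le_log (hap n) (hB n)
    rwa [Real.log_mul hCp.ne' (pow_pos hrp n).ne', Real.log_pow] at this
  have hK := le_abs_self (Real.log C)
  have hK0 := abs_nonneg (Real.log C)
  set K := |Real.log C|
  refine ⟨2 * K + L, by positivity, fun t ht => ?_⟩
  have hq : 0 ≤ (t + K) / L := by positivity
  refine ⟨⌊(t + K) / L⌋₊ + 1, by omega, ?_, ?_⟩
  · have h3 := (Nat.lt_floor_add_one ((t + K) / L)).le
    rw [div_le_iff₀ hL] at h3
    have := hA' (⌊(t + K) / L⌋₊ + 1)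
    push_cast at this
    linarith
  · have h3 := Nat.floor_le hq
    rw [le_div_iff₀ hL] at h3
    have := hB' (⌊(t + K) / L⌋₊ + 1)
    push_cast at this
    linarith
end

section
/- Let 0 < k < 1/2, a > 0 and β be reals with 0 < β < 2·k·a, and set θ0 := ((1−k)·a − β/2)/(a − β); then θ0 ∈ (0,1), and for every c > 0 there exists C > 0, depending only on a, β, k and c, with the following property: for every T ∈ ℕ and every sequence σ_1, …, σ_T of nonnegative reals such that σ_h ≥ c·h^a whenever σ_h > 0, one has ∑_{h=1}^{T} σ_h^{1−k}·h^{−β/2} ≤ C·( ∑_{h=1}^{T} σ_h·h^{−β} )^{θ0} · ( #{1 ≤ h ≤ T : σ_h > 0} )^{1−θ0}. -/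
theorem hoelder_aux (s : Finset ℕ) (x : ℕ → ℝ) (hx : ∀ h ∈ s, 0 ≤ x h) (θ : ℝ) (h0 : 0 < θ)
    (h1 : θ < 1) : ∑ h ∈ s, x h ^ θ ≤ (∑ h ∈ s, x h) ^ θ * (s.card : ℝ) ^ (1 - θ) := by
  have hpq : (1 / θ).HolderConjugate (1 / (1 - θ)) := by
    rw [Real.holderConjugate_iff]
    refine ⟨by rw [lt_div_iff₀ h0]; linarith, ?_⟩
    simp
  have key := Real.inner_le_Lp_mul_Lq_of_nonneg s (f := fun h => x h ^ θ) (g := fun _ => (1 : ℝ))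
    hpq (fun i hi => Real.rpow_nonneg (hx i hi) _) (fun _ _ => zero_le_one)
  have e : ∑ h ∈ s, (x h ^ θ) ^ (1 / θ) = ∑ h ∈ s, x h := by
    refine Finset.sum_congr rfl fun i hi => ?_
    rw [← Real.rpow_mul (hx i hi), mul_one_div_cancel h0.ne', Real.rpow_one]
  simp only [mul_one, Real.one_rpow, e, one_div_one_div, Finset.sum_const, nsmul_eq_mul] at key
  exact key

/-- The Hölder-inequality optimization from the proof of Theorem 3.2 ('ae-disc'). -/
theorem hoelder_optimization (k a β : ℝ) (hk0 : 0 < k) (hk : k < 1 / 2) (ha : 0 < a)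
    (hβ0 : 0 < β) (hβ : β < 2 * k * a) :
    (0 < ((1 - k) * a - β / 2) / (a - β) ∧ ((1 - k) * a - β / 2) / (a - β) < 1) ∧
      ∀ c : ℝ, 0 < c → ∃ C : ℝ, 0 < C ∧
        ∀ (T : ℕ) (σ : ℕ → ℝ),
          (∀ h ∈ Finset.Icc 1 T, 0 ≤ σ h) →
          (∀ h ∈ Finset.Icc 1 T, 0 < σ h → c * (h : ℝ) ^ a ≤ σ h) →
          ∑ h ∈ Finset.Icc 1 T, σ h ^ (1 - k) * (h : ℝ) ^ (-(β / 2)) ≤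
            C * (∑ h ∈ Finset.Icc 1 T, σ h * (h : ℝ) ^ (-β)) ^
                (((1 - k) * a - β / 2) / (a - β)) *
              (((Finset.Icc 1 T).filter fun h => 0 < σ h).card : ℝ) ^
                (1 - ((1 - k) * a - β / 2) / (a - β)) := by
  have hab : 0 < a - β := by nlinarith
  have hθ0 : 0 < ((1 - k) * a - β / 2) / (a - β) := div_pos (by nlinarith) hab
  have hθ1 : ((1 - k) * a - β / 2) / (a - β) < 1 := by
    rw [div_lt_one hab]; nlinarith
  refine ⟨⟨hθ0, hθ1⟩, ?_⟩
  have e1 : (1 - k) - ((1 - k) * a - β / 2) / (a - β) = -(β * (1 / 2 - k) / (a - β)) := by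
    field_simp; ring
  have e2 : a * -(β * (1 / 2 - k) / (a - β)) =
      β / 2 - β * (((1 - k) * a - β / 2) / (a - β)) := by
    field_simp; ring
  have hA : 0 < β * (1 / 2 - k) / (a - β) := div_pos (mul_pos hβ0 (by linarith)) hab
  generalize ((1 - k) * a - β / 2) / (a - β) = θ at *
  generalize β * (1 / 2 - k) / (a - β) = A at *
  intro c hc
  refine ⟨c ^ (-A), Real.rpow_pos_of_pos hc _, ?_⟩
  intro T σ hσ hlow
  set s := (Finset.Icc 1 T).filter fun h => 0 < σ h with hs
  have hz : ∀ h ∈ Finset.Icc 1 T, h ∉ s → σ h = 0 := by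
    intro h hh hn
    by_contra hne
    exact hn (Finset.mem_filter.2 ⟨hh, lt_of_le_of_ne (hσ h hh) (Ne.symm hne)⟩)
  have S1 : ∑ h ∈ s, σ h ^ (1 - k) * (h : ℝ) ^ (-(β / 2)) =
      ∑ h ∈ Finset.Icc 1 T, σ h ^ (1 - k) * (h : ℝ) ^ (-(β / 2)) := by
    refine Finset.sum_subset (Finset.filter_subset _ _) fun h hh hn => ?_
    rw [hz h hh hn, Real.zero_rpow (by linarith), zero_mul]
  have S2 : ∑ h ∈ s, σ h * (h : ℝ) ^ (-β) = ∑ h ∈ Finset.Icc 1 T, σ h * (h : ℝ) ^ (-β) := by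
    refine Finset.sum_subset (Finset.filter_subset _ _) fun h hh hn => ?_
    rw [hz h hh hn, zero_mul]
  rw [← S1, ← S2, mul_assoc]
  refine le_trans ?_ (mul_le_mul_of_nonneg_left
    (hoelder_aux s (fun h => σ h * (h : ℝ) ^ (-β)) ?_ θ hθ0 hθ1) (Real.rpow_nonneg hc.le _))
  · rw [Finset.mul_sum]
    refine Finset.sum_le_sum fun h hh => ?_
    obtain ⟨hI, hp⟩ := Finset.mem_filter.1 hh
    have hh0 : (0 : ℝ) < h := by
      have := (Finset.mem_Icc.1 hI).1
      exact_mod_cast this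
    have hb : σ h ^ (-A) ≤ c ^ (-A) * (h : ℝ) ^ (a * -A) := by
      rw [Real.rpow_mul hh0.le, ← Real.mul_rpow hc.le (Real.rpow_nonneg hh0.le _)]
      exact Real.rpow_le_rpow_of_nonpos (mul_pos hc (Real.rpow_pos_of_pos hh0 _))
        (hlow h hI hp) (by linarith)
    have f1 : σ h ^ (1 - k) = σ h ^ θ * σ h ^ (-A) := by
      rw [← Real.rpow_add hp]; congr 1; linarith
    have f2 : (h : ℝ) ^ (a * -A) * (h : ℝ) ^ (-(β / 2)) = (h : ℝ) ^ (-β * θ) := by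
      rw [← Real.rpow_add hh0]; congr 1; linarith
    calc σ h ^ (1 - k) * (h : ℝ) ^ (-(β / 2))
        = σ h ^ θ * σ h ^ (-A) * (h : ℝ) ^ (-(β / 2)) := by rw [f1]
      _ ≤ σ h ^ θ * (c ^ (-A) * (h : ℝ) ^ (a * -A)) * (h : ℝ) ^ (-(β / 2)) := by gcongr
      _ = c ^ (-A) * (σ h ^ θ * ((h : ℝ) ^ (a * -A) * (h : ℝ) ^ (-(β / 2)))) := by ring
      _ = c ^ (-A) * (σ h * (h : ℝ) ^ (-β)) ^ θ := by
        rw [f2, Real.mul_rpow hp.le (Real.rpow_nonneg hh0.le _), Real.rpow_mul hh0.le]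
  · intro h hh
    exact mul_nonneg (Finset.mem_filter.1 hh).2.le (Real.rpow_nonneg (Nat.cast_nonneg _) _)
end
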